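/- Averaging step in the characterization of Hamada coordinates (core of Theorem 5.3): Let I ⊆ ℝ be an open interval, let Ψ₁, Ψ₂ : I → Matrix (Fin 2) (Fin 2) ℝ be differentiable with Ψ₂′(ψ) an invertible matrix for every ψ ∈ I, let A be a real 2×2 matrix, and let ν : I × ℝ × ℝ → ℝ² be continuously differentiable and 2π-periodic in each of its last two arguments. Suppose that for all (ψ, θ, ζ) ∈ I × ℝ × ℝ: Ψ₁′(ψ) = Ψ₂′(ψ)·A + Ψ₂′(ψ)·Dν(ψ,θ,ζ), where Dν(ψ,θ,ζ) denotes the 2×2 Jacobian matrix of (θ,ζ) ↦ ν(ψ,θ,ζ). Then Ψ₁′(ψ) = Ψ₂′(ψ)·A for every ψ ∈ I, and ν(ψ,θ,ζ) = ν(ψ,0,0) for all (ψ,θ,ζ), i.e. ν depends only on ψ. -/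

import Mathlib

noncomputable section

/-- Entrywise derivative of a matrix-valued function of a real variable. -/
def mderiv (Ψ : ℝ → Matrix (Fin 2) (Fin 2) ℝ) (ψ : ℝ) : Matrix (Fin 2) (Fin 2) ℝ :=
  Matrix.of fun i j => deriv (fun t => Ψ t i j) ψ

/-- The 2×2 Jacobian of `(θ, ζ) ↦ ν (ψ, θ, ζ)`: its columns are the partial
derivatives of `ν` with respect to the angles `θ` and `ζ`. -/
def angleJacobian (ν : ℝ × ℝ × ℝ → Fin 2 → ℝ) (ψ θ ζ : ℝ) :
    Matrix (Fin 2) (Fin 2) ℝ :=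
  Matrix.of fun i j =>
    if j = 0 then deriv (fun t => ν (ψ, t, ζ) i) θ
    else deriv (fun t => ν (ψ, θ, t) i) ζ

theorem helper_const (f : ℝ → ℝ) (hf : Differentiable ℝ f) (hp : f (0 + 2 * Real.pi) = f 0)
    (hc : ∀ x y, deriv f x = deriv f y) : ∀ x, deriv f x = 0 := by
  obtain ⟨c, -, h⟩ := exists_deriv_eq_zero (f := f) (a := 0) (b := 0 + 2 * Real.pi)
    (by have := Real.pi_pos; linarith) hf.continuous.continuousOn hp.symm
  intro x
  rw [hc x c, h]

/-- **Averaging step in the characterization of Hamada coordinates**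
(core of Theorem 5.3). -/
theorem hamada_characterization_averaging
    (a b : ℝ)
    (Ψ₁ Ψ₂ : ℝ → Matrix (Fin 2) (Fin 2) ℝ)
    (hΨ₁ : ∀ ψ ∈ Set.Ioo a b, ∀ i j : Fin 2,
      DifferentiableAt ℝ (fun t => Ψ₁ t i j) ψ)
    (hΨ₂ : ∀ ψ ∈ Set.Ioo a b, ∀ i j : Fin 2,
      DifferentiableAt ℝ (fun t => Ψ₂ t i j) ψ)
    (hinv : ∀ ψ ∈ Set.Ioo a b, IsUnit (mderiv Ψ₂ ψ))
    (A : Matrix (Fin 2) (Fin 2) ℝ)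
    (ν : ℝ × ℝ × ℝ → Fin 2 → ℝ)
    (hν : ContDiffOn ℝ 1 ν ((Set.Ioo a b) ×ˢ (Set.univ : Set (ℝ × ℝ))))
    (hper₁ : ∀ ψ θ ζ : ℝ, ν (ψ, θ + 2 * Real.pi, ζ) = ν (ψ, θ, ζ))
    (hper₂ : ∀ ψ θ ζ : ℝ, ν (ψ, θ, ζ + 2 * Real.pi) = ν (ψ, θ, ζ))
    (heq : ∀ ψ ∈ Set.Ioo a b, ∀ θ ζ : ℝ,
      mderiv Ψ₁ ψ = mderiv Ψ₂ ψ * A + mderiv Ψ₂ ψ * angleJacobian ν ψ θ ζ) :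
    (∀ ψ ∈ Set.Ioo a b, mderiv Ψ₁ ψ = mderiv Ψ₂ ψ * A) ∧
    (∀ ψ ∈ Set.Ioo a b, ∀ θ ζ : ℝ, ν (ψ, θ, ζ) = ν (ψ, 0, 0)) := by
  have hd : ∀ ψ ∈ Set.Ioo a b, ∀ θ ζ : ℝ, DifferentiableAt ℝ ν (ψ, θ, ζ) := by
    intro ψ hψ θ ζ
    have hop : IsOpen ((Set.Ioo a b) ×ˢ (Set.univ : Set (ℝ × ℝ))) := isOpen_Ioo.prod isOpen_univ
    exact (hν.differentiableOn (by norm_num)).differentiableAt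
      (hop.mem_nhds ⟨hψ, Set.mem_univ _⟩)
  have hd1 : ∀ ψ ∈ Set.Ioo a b, ∀ (ζ : ℝ) (i : Fin 2),
      Differentiable ℝ (fun t => ν (ψ, t, ζ) i) := by
    intro ψ hψ ζ i t
    have h1 : DifferentiableAt ℝ (fun t : ℝ => ν (ψ, t, ζ)) t :=
      DifferentiableAt.comp (f := fun t : ℝ => (ψ, t, ζ)) t (hd ψ hψ t ζ) (by fun_prop)
    exact differentiableAt_pi.1 h1 i
  have hd2 : ∀ ψ ∈ Set.Ioo a b, ∀ (θ : ℝ) (i : Fin 2),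
      Differentiable ℝ (fun t => ν (ψ, θ, t) i) := by
    intro ψ hψ θ i t
    have h1 : DifferentiableAt ℝ (fun t : ℝ => ν (ψ, θ, t)) t :=
      DifferentiableAt.comp (f := fun t : ℝ => (ψ, θ, t)) t (hd ψ hψ θ t) (by fun_prop)
    exact differentiableAt_pi.1 h1 i
  have hJ : ∀ ψ ∈ Set.Ioo a b, ∀ θ ζ θ' ζ' : ℝ,
      angleJacobian ν ψ θ ζ = angleJacobian ν ψ θ' ζ' := by
    intro ψ hψ θ ζ θ' ζ'
    have h := (heq ψ hψ θ ζ).symm.trans (heq ψ hψ θ' ζ')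
    exact (hinv ψ hψ).mul_left_cancel (add_left_cancel h)
  have z1 : ∀ ψ ∈ Set.Ioo a b, ∀ (ζ : ℝ) (i : Fin 2) (θ : ℝ),
      deriv (fun t => ν (ψ, t, ζ) i) θ = 0 := by
    intro ψ hψ ζ i
    apply helper_const _ (hd1 ψ hψ ζ i)
    · exact congrFun (hper₁ ψ 0 ζ) i
    · intro x y
      have h := congrFun (congrFun (hJ ψ hψ x ζ y ζ) i) 0
      simpa [angleJacobian] using h
  have z2 : ∀ ψ ∈ Set.Ioo a b, ∀ (θ : ℝ) (i : Fin 2) (ζ : ℝ),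
      deriv (fun t => ν (ψ, θ, t) i) ζ = 0 := by
    intro ψ hψ θ i
    apply helper_const _ (hd2 ψ hψ θ i)
    · exact congrFun (hper₂ ψ θ 0) i
    · intro x y
      have h := congrFun (congrFun (hJ ψ hψ θ x θ y) i) 1
      simpa [angleJacobian] using h
  refine ⟨?_, ?_⟩
  · intro ψ hψ
    have h0 : angleJacobian ν ψ 0 0 = 0 := by
      ext i j
      simp [angleJacobian, z1 ψ hψ, z2 ψ hψ]
    have h := heq ψ hψ 0 0
    rwa [h0, mul_zero, add_zero] at h
  · intro ψ hψ θ ζ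
    ext i
    have e1 := is_const_of_deriv_eq_zero (hd1 ψ hψ ζ i) (z1 ψ hψ ζ i) θ 0
    have e2 := is_const_of_deriv_eq_zero (hd2 ψ hψ 0 i) (z2 ψ hψ 0 i) ζ 0
    exact e1.trans e2
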